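/- arXiv:1412.6777 — 2 statements merged into one kernel-verified Lean document; each statement's English description precedes it below -/
import Mathlib

section
/- Sign of the derivative of the phase function along vertical lines to the right of 1 + 1/M (part of Lemma 3.2): Fix an integer M ≥ 1. Then for every real c > 0 and every real a > 0, the derivative (d/dy) Re F̂(1 + 1/M + c + iy; a) is strictly negative for y > 0 and strictly positive for y < 0; in particular y ↦ Re F̂(1 + 1/M + c + iy; a) attains its strict maximum at y = 0. -/
open Complex Real Set Filter

/-- The phase function `F̂(z; a)` (principal branch of `log`). -/
noncomputable def Fhat (M : ℕ) (z : ℂ) (a : ℝ) : ℂ :=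
  ((M : ℂ) + 1) * z * (Complex.log z - 1) - (z - 1) * (Complex.log (z - 1) - 1) -
    z * (Real.log a : ℂ)

/-- The parametrization `ζ(φ)` of the steepest ascent curve. -/
noncomputable def zeta (M : ℕ) (φ : ℝ) : ℂ :=
  ((Real.sin ((M + 1) * φ) / Real.sin (M * φ) : ℝ) : ℂ) * Complex.exp ((φ : ℂ) * Complex.I)

/-- The parametrization `v(φ)` of the spectral variable. -/
noncomputable def v (M : ℕ) (φ : ℝ) : ℝ :=
  Real.sin ((M + 1) * φ) ^ (M + 1) / (Real.sin φ * Real.sin (M * φ) ^ M)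

open Complex in
theorem hasDerivAt_add_ofReal_mul_I (z : ℂ) (t : ℝ) :
    HasDerivAt (fun s : ℝ => z + (s : ℂ) * I) I t := by
  simpa using ((ofRealCLM.hasDerivAt (x := t)).mul_const I).const_add z

/-- The complex derivative of the phase function. -/
theorem hasDerivAt_Fhat (M : ℕ) (a : ℝ) {z : ℂ} (hz : z ∈ Complex.slitPlane)
    (hz' : z - 1 ∈ Complex.slitPlane) :
    HasDerivAt (fun w => Fhat M w a)
      (((M : ℂ) + 1) * Complex.log z - Complex.log (z - 1) - (Real.log a : ℂ)) z := by
  have h0 : z ≠ 0 := Complex.slitPlane_ne_zero hz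
  have h1 : z - 1 ≠ 0 := Complex.slitPlane_ne_zero hz'
  have hid := hasDerivAt_id z
  have hs : HasDerivAt (fun w : ℂ => w - 1) 1 z := hid.sub_const 1
  have key := (((hid.const_mul ((M : ℂ) + 1)).mul ((hid.clog hz).sub_const 1)).sub
    (hs.mul ((hs.clog hz').sub_const 1))).sub (hid.mul_const (Real.log a : ℂ))
  refine key.congr_deriv ?_
  simp only [id]
  field_simp
  ring

/-- The derivative of `y ↦ Re F̂(x + iy; a)` for `x > 1`. -/
noncomputable def verticalSlope (M : ℕ) (x t : ℝ) : ℝ :=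
  (Complex.log ((x : ℂ) - 1 + t * Complex.I)).im -
    (M + 1) * (Complex.log ((x : ℂ) + t * Complex.I)).im

theorem hasDerivAt_re_Fhat_vertical (M : ℕ) (a : ℝ) {x : ℝ} (hx : 1 < x) (t : ℝ) :
    HasDerivAt (fun s : ℝ => (Fhat M ((x : ℂ) + (s : ℂ) * Complex.I) a).re)
      (verticalSlope M x t) t := by
  have hz : (x : ℂ) + t * Complex.I ∈ Complex.slitPlane := by
    left; simp; linarith
  have hz' : (x : ℂ) + t * Complex.I - 1 ∈ Complex.slitPlane := by
    left; simp; linarith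
  have h := (hasDerivAt_Fhat M a hz hz').comp t (hasDerivAt_add_ofReal_mul_I x t)
  have h2 := Complex.reCLM.hasFDerivAt.comp_hasDerivAt t h
  refine h2.congr_deriv ?_
  have e : (x : ℂ) + t * Complex.I - 1 = (x : ℂ) - 1 + t * Complex.I := by ring
  rw [verticalSlope, ← e]
  simp

theorem hasDerivAt_verticalSlope (M : ℕ) {x : ℝ} (hx : 1 < x) (t : ℝ) :
    HasDerivAt (verticalSlope M x)
      ((x - 1) / ((x - 1) ^ 2 + t ^ 2) - (M + 1) * (x / (x ^ 2 + t ^ 2))) t := by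
  have hz : (x : ℂ) + t * Complex.I ∈ Complex.slitPlane := by
    left; simp; linarith
  have hz' : (x : ℂ) - 1 + t * Complex.I ∈ Complex.slitPlane := by
    left; simp; linarith
  have h1 := Complex.imCLM.hasFDerivAt.comp_hasDerivAt t
    ((hasDerivAt_add_ofReal_mul_I ((x : ℂ) - 1) t).clog_real hz')
  have h2 := Complex.imCLM.hasFDerivAt.comp_hasDerivAt t
    ((hasDerivAt_add_ofReal_mul_I (x : ℂ) t).clog_real hz)
  refine (h1.sub (h2.const_mul ((M : ℝ) + 1))).congr_deriv ?_
  simp [Complex.div_im, Complex.normSq_apply, pow_two]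

theorem strictAnti_verticalSlope {M : ℕ} {x : ℝ} (hx : 1 < x) (hMx : (M : ℝ) + 1 < M * x) :
    StrictAnti (verticalSlope M x) := by
  refine strictAnti_of_hasDerivAt_neg (hasDerivAt_verticalSlope M hx) fun t => ?_
  have h0 : 0 < x - 1 := by linarith
  have hM : (0 : ℝ) ≤ M := M.cast_nonneg
  rw [sub_neg, ← mul_div_assoc, div_lt_div_iff₀ (by positivity) (by positivity)]
  have h1 : 0 < x * (x - 1) * (M * x - (M + 1)) :=
    mul_pos (mul_pos (by linarith) h0) (by linarith)
  have h2 : 0 ≤ (M * x + 1) * t ^ 2 := by positivity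
  nlinarith

theorem verticalSlope_zero (M : ℕ) {x : ℝ} (hx : 1 < x) : verticalSlope M x 0 = 0 := by
  have h1 : (Complex.arg ((x : ℂ) - 1)) = 0 := by
    exact_mod_cast Complex.arg_ofReal_of_nonneg (x := x - 1) (by linarith)
  have h2 : Complex.arg (x : ℂ) = 0 := Complex.arg_ofReal_of_nonneg (by linarith)
  simp [verticalSlope, Complex.log_im, h1, h2]

/-- A real function whose derivative has the sign opposite to its argument is strictly maximal
at the origin. -/
theorem lt_apply_zero_of_hasDerivAt {f f' : ℝ → ℝ} (hf : ∀ t, HasDerivAt f (f' t) t)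
    (hpos : ∀ t, 0 < t → f' t < 0) (hneg : ∀ t, t < 0 → 0 < f' t) {y : ℝ} (hy : y ≠ 0) :
    f y < f 0 := by
  have hc : Continuous f := continuous_iff_continuousAt.2 fun t => (hf t).continuousAt
  rcases hy.lt_or_gt with h | h
  · refine strictMonoOn_of_deriv_pos (convex_Iic (0 : ℝ)) hc.continuousOn (fun t ht => ?_)
      h.le Set.self_mem_Iic h
    rw [(hf t).deriv]
    exact hneg t (by simpa using ht)
  · refine strictAntiOn_of_deriv_neg (convex_Ici (0 : ℝ)) hc.continuousOn (fun t ht => ?_)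
      Set.self_mem_Ici h.le h
    rw [(hf t).deriv]
    exact hpos t (by simpa using ht)

/-- Sign of the derivative of the phase function along vertical lines to the right of
`1 + 1/M`, and the resulting strict maximum at `y = 0` (part of Lemma 3.2). -/
theorem derivative_sign_on_vertical_line_right_of_edge
    (M : ℕ) (hM : 1 ≤ M) (c : ℝ) (hc : 0 < c) (a : ℝ) (ha : 0 < a) :
    (∀ y : ℝ, 0 < y →
      deriv (fun t : ℝ =>
        (Fhat M ((1 + 1/(M : ℂ) + (c : ℂ)) + (t : ℂ) * Complex.I) a).re) y < 0) ∧
    (∀ y : ℝ, y < 0 →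
      0 < deriv (fun t : ℝ =>
        (Fhat M ((1 + 1/(M : ℂ) + (c : ℂ)) + (t : ℂ) * Complex.I) a).re) y) ∧
    (∀ y : ℝ, y ≠ 0 →
      (Fhat M ((1 + 1/(M : ℂ) + (c : ℂ)) + (y : ℂ) * Complex.I) a).re <
        (Fhat M (1 + 1/(M : ℂ) + (c : ℂ)) a).re) := by
  have hM' : (0 : ℝ) < M := by exact_mod_cast hM
  obtain ⟨x, hx⟩ : ∃ x : ℝ, x = 1 + 1 / (M : ℝ) + c := ⟨_, rfl⟩
  have hxc : (1 + 1 / (M : ℂ) + (c : ℂ)) = (x : ℂ) := by rw [hx]; push_cast; rfl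
  have h1x : 1 < x := by
    have : 0 < 1 / (M : ℝ) := by positivity
    linarith
  have hMx : (M : ℝ) + 1 < M * x := by
    have : (M : ℝ) * x = M + 1 + M * c := by rw [hx]; field_simp
    nlinarith [mul_pos hM' hc]
  rw [hxc]
  have hd := hasDerivAt_re_Fhat_vertical M a h1x
  have hanti := strictAnti_verticalSlope h1x hMx
  have hzero := verticalSlope_zero M h1x
  have hpos : ∀ y : ℝ, 0 < y → verticalSlope M x y < 0 := fun y hy => hzero ▸ hanti hy
  have hneg : ∀ y : ℝ, y < 0 → 0 < verticalSlope M x y := fun y hy => hzero ▸ hanti hy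
  refine ⟨fun y hy => ?_, fun y hy => ?_, fun y hy => ?_⟩
  · rw [(hd y).deriv]
    exact hpos y hy
  · rw [(hd y).deriv]
    exact hneg y hy
  · simpa using lt_apply_zero_of_hasDerivAt hd hpos hneg hy
end

section
/- Saddle point equation in the bulk: Fix an integer M ≥ 1, let φ ∈ (0, π/(M+1)) and set x0 = v(φ) and w_± = (sin((M+1)φ)/sin(Mφ))·e^{±iφ}. Then the derivative F̂_z(z; x0) = (M+1)·Log z − Log(z − 1) − log x0 of F̂(z; x0) vanishes at z = w_+ and at z = w_−; that is, (M+1)·Log w_± − Log(w_± − 1) = log x0 exactly (with principal branches, no 2πi correction). -/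
open Complex Real Set Filter

theorem Complex.log_ofReal_mul_exp_ofReal_mul_I {r θ : ℝ} (hr : 0 < r) (h₁ : -Real.pi < θ)
    (h₂ : θ ≤ Real.pi) :
    Complex.log ((r : ℂ) * Complex.exp ((θ : ℂ) * Complex.I)) =
      (Real.log r : ℂ) + (θ : ℂ) * Complex.I := by
  rw [Complex.log_ofReal_mul hr (Complex.exp_ne_zero _),
    Complex.log_exp (by simpa using h₁) (by simpa using h₂)]

theorem zeta_sub_one (M : ℕ) {φ : ℝ} (h : Real.sin (M * φ) ≠ 0) :
    zeta M φ - 1 = ((Real.sin φ / Real.sin (M * φ) : ℝ) : ℂ) *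
      Complex.exp ((((M + 1) * φ : ℝ) : ℂ) * Complex.I) := by
  have hs : Real.sin ((M + 1) * φ) =
      Real.sin (M * φ) * Real.cos φ + Real.cos (M * φ) * Real.sin φ := by
    rw [add_one_mul, Real.sin_add]
  have hc : Real.cos ((M + 1) * φ) =
      Real.cos (M * φ) * Real.cos φ - Real.sin (M * φ) * Real.sin φ := by
    rw [add_one_mul, Real.cos_add]
  rw [zeta, Complex.exp_mul_I, Complex.exp_mul_I, ← Complex.ofReal_cos, ← Complex.ofReal_sin,
    ← Complex.ofReal_cos, ← Complex.ofReal_sin]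
  apply Complex.ext
  · simp only [Complex.sub_re, Complex.add_re, Complex.ofReal_re,
      Complex.mul_re, Complex.I_re, Complex.I_im, Complex.ofReal_im, Complex.one_re]
    rw [hs, hc]
    field_simp
    linear_combination Real.sin (M * φ) * Real.sin_sq_add_cos_sq φ
  · simp only [Complex.sub_im, Complex.add_im, Complex.ofReal_re,
      Complex.mul_im, Complex.I_re, Complex.I_im, Complex.ofReal_im, Complex.one_im]
    ring

theorem log_v (M : ℕ) {φ : ℝ} (h₁ : Real.sin ((M + 1) * φ) ≠ 0) (h₂ : Real.sin φ ≠ 0)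
    (h₃ : Real.sin (M * φ) ≠ 0) :
    Real.log (v M φ) = (M + 1) * Real.log (Real.sin ((M + 1) * φ) / Real.sin (M * φ)) -
      Real.log (Real.sin φ / Real.sin (M * φ)) := by
  rw [v, Real.log_div (pow_ne_zero _ h₁) (mul_ne_zero h₂ (pow_ne_zero _ h₃)),
    Real.log_mul h₂ (pow_ne_zero _ h₃), Real.log_pow, Real.log_pow, Real.log_div h₁ h₃,
    Real.log_div h₂ h₃]
  push_cast
  ring

/-- Saddle point equation in the bulk: `F̂_z` vanishes at `w₊ = ζ(φ)` and
`w₋ = conj(ζ(φ))`, with principal branches and no `2πi` correction. -/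
theorem saddle_point_equation_bulk
    (M : ℕ) (hM : 1 ≤ M)
    (φ : ℝ) (hφ : φ ∈ Set.Ioo (0 : ℝ) (Real.pi / ((M : ℝ) + 1))) :
    ((M : ℂ) + 1) * Complex.log (zeta M φ) - Complex.log (zeta M φ - 1) =
      ((Real.log (v M φ) : ℝ) : ℂ) ∧
    ((M : ℂ) + 1) * Complex.log ((starRingEnd ℂ) (zeta M φ)) -
        Complex.log ((starRingEnd ℂ) (zeta M φ) - 1) =
      ((Real.log (v M φ) : ℝ) : ℂ) := by
  obtain ⟨h0, hlt⟩ := hφ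
  have hM' : (1 : ℝ) ≤ M := by exact_mod_cast hM
  have hπ : (M + 1) * φ < Real.pi := by
    rwa [lt_div_iff₀ (by positivity), mul_comm] at hlt
  have hle : φ ≤ M * φ := le_mul_of_one_le_left h0.le hM'
  have hadd : (M + 1) * φ = M * φ + φ := add_one_mul _ _
  have hs₁ : 0 < Real.sin ((M + 1) * φ) := Real.sin_pos_of_pos_of_lt_pi (by positivity) hπ
  have hs : 0 < Real.sin φ := Real.sin_pos_of_pos_of_lt_pi h0 (by linarith)
  have hsM : 0 < Real.sin (M * φ) :=
    Real.sin_pos_of_pos_of_lt_pi (by linarith) (by linarith)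
  have hlog : Complex.log (zeta M φ) = _ :=
    Complex.log_ofReal_mul_exp_ofReal_mul_I (div_pos hs₁ hsM) (by linarith) (by linarith)
  have hlog' : Complex.log (zeta M φ - 1) = _ :=
    (congrArg Complex.log (zeta_sub_one M hsM.ne')).trans
      (Complex.log_ofReal_mul_exp_ofReal_mul_I (div_pos hs hsM) (by linarith) hπ.le)
  have key : ((M : ℂ) + 1) * Complex.log (zeta M φ) - Complex.log (zeta M φ - 1) =
      ((Real.log (v M φ) : ℝ) : ℂ) := by
    rw [hlog, hlog', log_v M hs₁.ne' hs.ne' hsM.ne']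
    push_cast
    ring
  have harg : (zeta M φ).arg ≠ Real.pi := by
    rw [← Complex.log_im, hlog]
    simpa using (show φ < Real.pi by linarith).ne
  have harg' : (zeta M φ - 1).arg ≠ Real.pi := by
    rw [← Complex.log_im, hlog']
    simpa using hπ.ne
  refine ⟨key, ?_⟩
  rw [← map_one (starRingEnd ℂ), ← map_sub, Complex.log_conj _ harg, Complex.log_conj _ harg']
  simpa using congrArg (starRingEnd ℂ) key
end
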